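/- arXiv:math/0511537 — 2 statements merged into one kernel-verified Lean document; each statement's English description precedes it below -/
import Mathlib

section
/- Let λ, μ ⊆ ℓ×k be partitions whose placements (λ top-left, rotate(μ) bottom-right) are disjoint, and suppose the union λ ∪ rotate(μ) contains a full column of length ℓ. Let λ̃, μ̃ ⊆ ℓ×(k−1) be obtained by deleting that column. Then there exists ν ⊆ ℓ×k with c^ν_{λ,μ} ≥ 2 if and only if there exists ν̃ ⊆ ℓ×(k−1) with c^{ν̃}_{λ̃,μ̃} ≥ 2. -/
/-- `f` is a partition: weakly decreasing and eventually zero (0-indexed parts). -/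
def IsPartition (f : ℕ → ℕ) : Prop :=
  (∀ i j, i ≤ j → f j ≤ f i) ∧ ∃ N, ∀ i, N ≤ i → f i = 0

/-- The partition `f` is contained in the `l × k` rectangle. -/
def InRect (f : ℕ → ℕ) (l k : ℕ) : Prop :=
  IsPartition f ∧ f 0 ≤ k ∧ ∀ i, l ≤ i → f i = 0

/-- Number of nonzero parts of `f`. -/
noncomputable def numParts (f : ℕ → ℕ) : ℕ := {i | f i ≠ 0}.ncard

/-- Number of distinct nonzero part sizes of `f`. -/
noncomputable def numPartSizes (f : ℕ → ℕ) : ℕ := {n | n ≠ 0 ∧ ∃ i, f i = n}.ncard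

/-- The cell `c = (i,j)` (0-indexed) lies in the skew shape `ν/λ`. -/
def InSkew (ν lam : ℕ → ℕ) (c : ℕ × ℕ) : Prop := lam c.1 ≤ c.2 ∧ c.2 < ν c.1

/-- `c'` strictly precedes `c` in the right-to-left, top-to-bottom reading order. -/
def ReadBefore (c' c : ℕ × ℕ) : Prop := c'.1 < c.1 ∨ (c'.1 = c.1 ∧ c.2 < c'.2)

/-- `T` is a Littlewood–Richardson filling of the skew shape `ν/λ` with content `μ`:
a semistandard filling (positive entries, rows weakly increasing, columns strictly
increasing) whose entry `m+1` occurs `μ m` times, and whose right-to-left,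
top-to-bottom reading word is a ballot sequence. -/
def IsLRFilling (lam mu ν : ℕ → ℕ) (T : ℕ × ℕ → ℕ) : Prop :=
  (∀ c, ¬ InSkew ν lam c → T c = 0) ∧
  (∀ c, InSkew ν lam c → 1 ≤ T c) ∧
  (∀ i j j', InSkew ν lam (i, j) → InSkew ν lam (i, j') → j ≤ j' →
      T (i, j) ≤ T (i, j')) ∧
  (∀ i j, InSkew ν lam (i, j) → InSkew ν lam (i + 1, j) → T (i, j) < T (i + 1, j)) ∧
  (∀ m, {c | InSkew ν lam c ∧ T c = m + 1}.Finite ∧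
      {c | InSkew ν lam c ∧ T c = m + 1}.ncard = mu m) ∧
  (∀ c, InSkew ν lam c → ∀ m, 1 ≤ m →
      {c' | InSkew ν lam c' ∧ (ReadBefore c' c ∨ c' = c) ∧ T c' = m + 1}.ncard ≤
      {c' | InSkew ν lam c' ∧ (ReadBefore c' c ∨ c' = c) ∧ T c' = m}.ncard)

/-- The Littlewood–Richardson coefficient `c^ν_{λ,μ}`. -/
noncomputable def lrCoeff (lam mu ν : ℕ → ℕ) : ℕ :=
  Nat.card {T : ℕ × ℕ → ℕ // IsLRFilling lam mu ν T}

/-- Box `c = (i,j)` of the rectangle lies in `λ` placed at the top-left. -/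
def InLam (lam : ℕ → ℕ) (c : ℕ × ℕ) : Prop := c.2 < lam c.1

/-- Box `c = (i,j)` of `l × k` lies in `rotate(μ)`, i.e. `μ` rotated 180° and
placed at the bottom-right. -/
def InRot (mu : ℕ → ℕ) (l k : ℕ) (c : ℕ × ℕ) : Prop := k - mu (l - 1 - c.1) ≤ c.2

/-- The placements of `λ` (top-left) and `rotate(μ)` (bottom-right) in `l × k`
are disjoint. -/
def DisjointPlace (lam mu : ℕ → ℕ) (l k : ℕ) : Prop :=
  ∀ c : ℕ × ℕ, c.1 < l → c.2 < k → ¬ (InLam lam c ∧ InRot mu l k c)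

/-- Column `j` of `l × k` is full for `λ ∪ rotate(μ)`. -/
def FullCol (lam mu : ℕ → ℕ) (l k j : ℕ) : Prop :=
  ∀ i, i < l → (InLam lam (i, j) ∨ InRot mu l k (i, j))

/-- Row `i` of `l × k` is full for `λ ∪ rotate(μ)`. -/
def FullRow (lam mu : ℕ → ℕ) (l k i : ℕ) : Prop :=
  ∀ j, j < k → (InLam lam (i, j) ∨ InRot mu l k (i, j))

/-- `(λ, μ, l × k)` is a basic Richardson quadruple. -/
def BasicRQ (lam mu : ℕ → ℕ) (l k : ℕ) : Prop :=
  InRect lam l k ∧ InRect mu l k ∧ DisjointPlace lam mu l k ∧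
  (∀ j, j < k → ¬ FullCol lam mu l k j) ∧ (∀ i, i < l → ¬ FullRow lam mu l k i)

/-- The rectangle partition `(g^h)`. -/
def rectP (g h : ℕ) : ℕ → ℕ := fun i => if i < h then g else 0

/-- The hook partition `(b, 1^a)`. -/
def hookP (b a : ℕ) : ℕ → ℕ := fun i => if i = 0 then b else if i ≤ a then 1 else 0

/-- Delete column `j` (0-indexed) of the rectangle from `λ` (placed top-left). -/
def delCol (f : ℕ → ℕ) (j : ℕ) : ℕ → ℕ := fun i => if j < f i then f i - 1 else f i

/-- Delete column `j` (0-indexed) of the `_ × k` rectangle from `μ` (placed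
rotated at the bottom-right). -/
def delColMu (k : ℕ) (f : ℕ → ℕ) (j : ℕ) : ℕ → ℕ :=
  fun i => if k - j ≤ f i then f i - 1 else f i

/-- Number of boxes in rows `< n` lying between the `m`-th and `(m+1)`-st boundaries of `L`. -/
def stripCount (L : ℕ → ℕ → ℕ) (n m : ℕ) : ℕ := ∑ i ∈ Finset.range n, (L i (m + 1) - L i m)

/-- The inequalities satisfied by the row boundaries `L i m` (the first column of row `i` past the
entries `≤ m`) of a Littlewood–Richardson filling with at most `l` rows. -/
structure IsLRPattern (l : ℕ) (lam mu ν : ℕ → ℕ) (L : ℕ → ℕ → ℕ) : Prop where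
  zero : ∀ i, L i 0 = lam i
  mono : ∀ i m, L i m ≤ L i (m + 1)
  le : ∀ i m, L i m ≤ ν i
  eventually : ∀ i, ∃ m, L i m = ν i
  col : ∀ i m, L (i + 1) (m + 1) ≤ L i m
  content : ∀ m, stripCount L l m = mu m
  ballot : ∀ i m, i < l → stripCount L (i + 1) (m + 1) ≤ stripCount L i m

/-- `L` records the row boundaries of the filling `T` of `ν/λ`. -/
structure IsBoundary (lam ν : ℕ → ℕ) (T : ℕ × ℕ → ℕ) (L : ℕ → ℕ → ℕ) : Prop where
  support : ∀ c, ¬ InSkew ν lam c → T c = 0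
  ge : ∀ i m, lam i ≤ L i m
  le : ∀ i m, L i m ≤ ν i
  iff : ∀ i m c, InSkew ν lam (i, c) → (T (i, c) ≤ m ↔ c < L i m)

theorem stripCount_succ (L : ℕ → ℕ → ℕ) (n m : ℕ) :
    stripCount L (n + 1) m = stripCount L n m + (L n (m + 1) - L n m) :=
  Finset.sum_range_succ _ _

theorem stripCount_mono (L : ℕ → ℕ → ℕ) (m : ℕ) : Monotone fun n => stripCount L n m :=
  monotone_nat_of_le_succ fun n => by rw [stripCount_succ]; omega

namespace IsBoundary

variable {lam mu ν : ℕ → ℕ} {T T' : ℕ × ℕ → ℕ} {L L' : ℕ → ℕ → ℕ} {l : ℕ}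

theorem mono (h : IsBoundary lam ν T L) (i m : ℕ) : L i m ≤ L i (m + 1) := by
  by_contra! hlt
  have h1 := h.ge i (m + 1)
  have h2 := h.le i m
  have hs : InSkew ν lam (i, L i (m + 1)) := ⟨h1, by simp only; omega⟩
  have := (h.iff i m _ hs).2 hlt
  have := (h.iff i (m + 1) _ hs).1 (by omega)
  omega

theorem eq_left (h : IsBoundary lam ν T L) (h' : IsBoundary lam ν T' L) : T = T' := by
  funext ⟨i, c⟩
  by_cases hs : InSkew ν lam (i, c)
  · refine le_antisymm ?_ ?_
    · rw [h.iff i _ c hs, ← h'.iff i _ c hs]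
    · rw [h'.iff i _ c hs, ← h.iff i _ c hs]
  · rw [h.support _ hs, h'.support _ hs]

theorem le_right (h : IsBoundary lam ν T L) (h' : IsBoundary lam ν T L') (i m : ℕ) :
    L i m ≤ L' i m := by
  by_contra! hlt
  have h2 := h.le i m
  have hs : InSkew ν lam (i, L' i m) := ⟨h'.ge i m, by simp only; omega⟩
  have := (h'.iff i m _ hs).1 ((h.iff i m _ hs).2 hlt)
  omega

theorem eq_right (h : IsBoundary lam ν T L) (h' : IsBoundary lam ν T L') : L = L' := by
  funext i m
  exact le_antisymm (h.le_right h' i m) (h'.le_right h i m)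

theorem mem_strip_iff (h : IsBoundary lam ν T L) (i m c : ℕ) :
    (InSkew ν lam (i, c) ∧ T (i, c) = m + 1) ↔ (L i m ≤ c ∧ c < L i (m + 1)) := by
  constructor
  · rintro ⟨hs, ht⟩
    have h1 := h.iff i m c hs
    have h2 := h.iff i (m + 1) c hs
    omega
  · rintro ⟨h1, h2⟩
    have h3 := h.ge i m
    have h4 := h.le i (m + 1)
    have hs : InSkew ν lam (i, c) := ⟨by simp only; omega, by simp only; omega⟩
    have h5 := h.iff i m c hs
    have h6 := h.iff i (m + 1) c hs
    exact ⟨hs, by omega⟩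

theorem finite_and_ncard_rows (h : IsBoundary lam ν T L) (n m : ℕ) :
    {c | InSkew ν lam c ∧ c.1 < n ∧ T c = m + 1}.Finite ∧
    {c | InSkew ν lam c ∧ c.1 < n ∧ T c = m + 1}.ncard = stripCount L n m := by
  have hset : {c | InSkew ν lam c ∧ c.1 < n ∧ T c = m + 1} =
      (((Finset.range n).sigma fun i => Finset.Ico (L i m) (L i (m + 1))).map
        (Equiv.sigmaEquivProd ℕ ℕ).toEmbedding : Finset (ℕ × ℕ)) := by
    ext ⟨i, c⟩
    have := h.mem_strip_iff i m c
    simp only [Set.mem_ofPred_eq, Finset.coe_map, Set.mem_image, Finset.mem_coe, Finset.mem_sigma,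
      Finset.mem_range, Finset.mem_Ico, Equiv.coe_toEmbedding, Equiv.sigmaEquivProd_apply,
      Prod.mk.injEq, Sigma.exists]
    constructor
    · rintro ⟨h1, h2, h3⟩
      exact ⟨i, c, ⟨h2, this.1 ⟨h1, h3⟩⟩, rfl, rfl⟩
    · rintro ⟨i', c', ⟨h2, h3⟩, rfl, rfl⟩
      have := this.2 h3
      exact ⟨this.1, h2, this.2⟩
  rw [hset]
  refine ⟨Finset.finite_toSet _, ?_⟩
  rw [Set.ncard_coe_finset, Finset.card_map, Finset.card_sigma]
  simp [stripCount]

theorem row_lt (hν : ∀ i, l ≤ i → ν i = 0) {c : ℕ × ℕ} (hc : InSkew ν lam c) : c.1 < l := by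
  by_contra! hle
  have := hν _ hle
  have := hc.2
  omega

theorem finite_and_ncard (h : IsBoundary lam ν T L) (hν : ∀ i, l ≤ i → ν i = 0) (m : ℕ) :
    {c | InSkew ν lam c ∧ T c = m + 1}.Finite ∧
    {c | InSkew ν lam c ∧ T c = m + 1}.ncard = stripCount L l m := by
  have : {c | InSkew ν lam c ∧ T c = m + 1} =
      {c | InSkew ν lam c ∧ c.1 < l ∧ T c = m + 1} := by
    ext c
    exact ⟨fun h => ⟨h.1, row_lt hν h.1, h.2⟩, fun h => ⟨h.1, h.2.2⟩⟩
  rw [this]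
  exact h.finite_and_ncard_rows l m

theorem isLRFilling (h : IsBoundary lam ν T L) (hν : ∀ i, l ≤ i → ν i = 0)
    (hL : IsLRPattern l lam mu ν L) : IsLRFilling lam mu ν T := by
  refine ⟨h.support, ?_, ?_, ?_, ?_, ?_⟩
  · rintro ⟨i, c⟩ hs
    have h1 := h.iff i 0 c hs
    have h2 := hL.zero i
    have h3 := hs.1
    simp only at h3
    omega
  · intro i c c' hs hs' hcc
    have h1 := (h.iff i _ c' hs').1 le_rfl
    exact (h.iff i _ c hs).2 (by omega)
  · intro i c hs hs'
    have h1 := (h.iff (i + 1) _ c hs').1 le_rfl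
    rcases ht : T (i + 1, c) with _ | m
    · rw [ht, hL.zero] at h1
      have := hs'.1
      simp only at this
      omega
    · rw [ht] at h1
      have := hL.col i m
      have := (h.iff i m c hs).2 (by omega)
      omega
  · intro m
    rw [← hL.content m]
    exact h.finite_and_ncard hν m
  · rintro ⟨i, c⟩ hs m hm
    obtain ⟨m, rfl⟩ : ∃ m', m = m' + 1 := ⟨m - 1, by omega⟩
    have hi : i < l := row_lt hν hs
    have h1 := h.finite_and_ncard_rows (i + 1) (m + 1)
    have h2 := h.finite_and_ncard_rows i m
    have h3 := h.finite_and_ncard_rows (i + 1) m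
    calc _ ≤ stripCount L (i + 1) (m + 1) := by
          rw [← h1.2]
          refine Set.ncard_le_ncard ?_ h1.1
          rintro ⟨i', c'⟩ ⟨hs', hr, ht⟩
          refine ⟨hs', ?_, ht⟩
          simp only [ReadBefore, Prod.mk.injEq] at hr
          simp only
          omega
      _ ≤ stripCount L i m := hL.ballot i m hi
      _ ≤ _ := by
          rw [← h2.2]
          refine Set.ncard_le_ncard ?_ (h3.1.subset ?_)
          · rintro ⟨i', c'⟩ ⟨hs', hr, ht⟩
            exact ⟨hs', Or.inl (Or.inl hr), ht⟩
          · rintro ⟨i', c'⟩ ⟨hs', hr, ht⟩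
            refine ⟨hs', ?_, ht⟩
            simp only [ReadBefore, Prod.mk.injEq] at hr
            simp only
            omega

theorem ballot_of_lt (h : IsBoundary lam ν T L) (hT : IsLRFilling lam mu ν T) {i m : ℕ}
    (hlt : L i (m + 1) < L i (m + 1 + 1)) : stripCount L (i + 1) (m + 1) ≤ stripCount L i m := by
  obtain ⟨hs, ht⟩ := (h.mem_strip_iff i (m + 1) (L i (m + 1))).2 ⟨le_rfl, hlt⟩
  have h1 := h.finite_and_ncard_rows (i + 1) (m + 1)
  have h2 := h.finite_and_ncard_rows i m
  rw [← h1.2, ← h2.2]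
  refine (Set.ncard_le_ncard ?_ (h1.1.subset ?_)).trans
    ((hT.2.2.2.2.2 _ hs (m + 1) (by omega)).trans (Set.ncard_le_ncard ?_ h2.1))
  · rintro ⟨i', c'⟩ ⟨hs', hi, ht'⟩
    refine ⟨hs', ?_, ht'⟩
    have := h.mem_strip_iff i' (m + 1) c'
    simp only [ReadBefore, Prod.mk.injEq]
    simp only at hi
    rcases Nat.lt_succ_iff_lt_or_eq.1 hi with hi | rfl
    · omega
    · have := (this.1 ⟨hs', ht'⟩).1
      omega
  · rintro ⟨i', c'⟩ ⟨hs', hr, ht'⟩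
    refine ⟨hs', ?_, ht'⟩
    simp only [ReadBefore, Prod.mk.injEq] at hr
    simp only
    omega
  · rintro ⟨i', c'⟩ ⟨hs', hr, ht'⟩
    refine ⟨hs', ?_, ht'⟩
    have := (h.mem_strip_iff i' m c').1 ⟨hs', ht'⟩
    simp only [ReadBefore, Prod.mk.injEq] at hr
    simp only
    by_contra hi
    obtain rfl : i' = i := by omega
    omega

theorem ballot (h : IsBoundary lam ν T L) (hT : IsLRFilling lam mu ν T) (i m : ℕ) :
    stripCount L (i + 1) (m + 1) ≤ stripCount L i m := by
  induction i with
  | zero =>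
    by_cases hlt : L 0 (m + 1) < L 0 (m + 1 + 1)
    · exact h.ballot_of_lt hT hlt
    · rw [stripCount_succ]
      simp only [stripCount, Finset.range_zero, Finset.sum_empty]
      omega
  | succ i ih =>
    by_cases hlt : L (i + 1) (m + 1) < L (i + 1) (m + 1 + 1)
    · exact h.ballot_of_lt hT hlt
    · rw [stripCount_succ]
      have : stripCount L i m ≤ stripCount L (i + 1) m := stripCount_mono L m (Nat.le_succ i)
      omega

theorem isLRPattern (h : IsBoundary lam ν T L) (hν : ∀ i, l ≤ i → ν i = 0)
    (hlam : Antitone lam) (hν' : Antitone ν) (hT : IsLRFilling lam mu ν T) :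
    IsLRPattern l lam mu ν L where
  zero i := by
    by_contra hne
    have h1 := h.ge i 0
    have h2 := h.le i 0
    have hs : InSkew ν lam (i, lam i) := ⟨le_rfl, by simp only; omega⟩
    have h3 := (h.iff i 0 _ hs).2 (by omega)
    have h4 := hT.2.1 _ hs
    omega
  mono := h.mono
  le := h.le
  eventually i := by
    rcases Nat.eq_zero_or_pos (ν i) with h0 | h0
    · exact ⟨0, by have := h.le i 0; omega⟩
    · by_cases hs : InSkew ν lam (i, ν i - 1)
      · refine ⟨T (i, ν i - 1), ?_⟩
        have := (h.iff i _ _ hs).1 le_rfl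
        have := h.le i (T (i, ν i - 1))
        omega
      · refine ⟨0, ?_⟩
        have h1 := h.ge i 0
        have h2 := h.le i 0
        simp only [InSkew] at hs
        omega
  col i m := by
    by_contra! hlt
    have h1 := h.ge i m
    have h2 := h.le (i + 1) (m + 1)
    have h3 := hν' (Nat.le_succ i)
    have h4 := hlam (Nat.le_succ i)
    simp only [Nat.succ_eq_add_one] at h3 h4
    have hs : InSkew ν lam (i, L i m) := ⟨h1, by simp only; omega⟩
    have hs' : InSkew ν lam (i + 1, L i m) := ⟨by simp only; omega, by simp only; omega⟩
    have h5 := (h.iff (i + 1) (m + 1) _ hs').2 hlt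
    have h6 := hT.2.2.2.1 _ _ hs hs'
    have h7 := (h.iff i m _ hs).1 (by omega)
    omega
  content m := by rw [← (h.finite_and_ncard hν m).2, (hT.2.2.2.2.1 m).2]
  ballot i m _ := h.ballot hT i m

end IsBoundary

theorem IsLRFilling.exists_isBoundary {lam mu ν : ℕ → ℕ} {T : ℕ × ℕ → ℕ}
    (hT : IsLRFilling lam mu ν T) (hle : ∀ i, lam i ≤ ν i) : ∃ L, IsBoundary lam ν T L := by
  have hex : ∀ i m, ∃ c, lam i ≤ c ∧ (c < ν i → m < T (i, c)) :=
    fun i m => ⟨ν i, hle i, fun h => absurd h (lt_irrefl _)⟩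
  classical
  refine ⟨fun i m => Nat.find (hex i m), hT.1, fun i m => (Nat.find_spec (hex i m)).1,
    fun i m => Nat.find_min' _ ⟨hle i, fun h => absurd h (lt_irrefl _)⟩, fun i m c hs => ?_⟩
  have hsp := Nat.find_spec (hex i m)
  have hmin := fun c => Nat.find_min (hex i m) (m := c)
  change T (i, c) ≤ m ↔ c < Nat.find (hex i m)
  generalize Nat.find (hex i m) = n at hsp hmin ⊢
  have hc1 := hs.1
  have hc2 := hs.2
  simp only at hc1 hc2
  constructor
  · intro ht
    by_contra! hc
    have h1 := hsp.2 (by omega)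
    have h2 := hT.2.2.1 i n c ⟨hsp.1, by simp only; omega⟩ hs hc
    omega
  · intro hc
    by_contra! ht
    exact hmin c hc ⟨hc1, fun _ => ht⟩

theorem IsLRPattern.exists_isBoundary {l : ℕ} {lam mu ν : ℕ → ℕ} {L : ℕ → ℕ → ℕ}
    (hL : IsLRPattern l lam mu ν L) : ∃ T, IsBoundary lam ν T L := by
  classical
  refine ⟨fun c => if InSkew ν lam c then sInf {m | c.2 < L c.1 m} else 0,
    fun c hc => if_neg hc, fun i m => ?_, hL.le, fun i m c hs => ?_⟩
  · rw [← hL.zero]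
    exact monotone_nat_of_le_succ (hL.mono i) (Nat.zero_le m)
  · rw [if_pos hs]
    constructor
    · intro h
      obtain ⟨M, hM⟩ := hL.eventually i
      have hne : {m | c < L i m}.Nonempty := ⟨M, by rw [Set.mem_ofPred_eq, hM]; exact hs.2⟩
      have h1 : c < L i (sInf {m | c < L i m}) := Nat.sInf_mem hne
      exact h1.trans_le (monotone_nat_of_le_succ (hL.mono i) h)
    · exact fun h => Nat.sInf_le h

/-- Littlewood–Richardson coefficients count patterns of row boundaries. -/
theorem lrCoeff_eq_card_pattern {l : ℕ} {lam mu ν : ℕ → ℕ} (hlam : Antitone lam)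
    (hν' : Antitone ν) (hν : ∀ i, l ≤ i → ν i = 0) (hle : ∀ i, lam i ≤ ν i) :
    lrCoeff lam mu ν = Nat.card {L // IsLRPattern l lam mu ν L} := by
  choose f hf using fun T : {T // IsLRFilling lam mu ν T} => T.2.exists_isBoundary hle
  refine Nat.card_eq_of_bijective
    (fun T => ⟨f T, (hf T).isLRPattern hν hlam hν' T.2⟩) ⟨fun T T' h => ?_, fun L => ?_⟩
  · have h1 : f T = f T' := congrArg Subtype.val h
    exact Subtype.ext ((hf T).eq_left (h1 ▸ hf T'))
  · obtain ⟨T, hT⟩ := L.2.exists_isBoundary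
    exact ⟨⟨T, hT.isLRFilling hν L.2⟩, Subtype.ext ((hf _).eq_right hT)⟩

/-- The unique pattern for `(1^a)`, `(1^(l-a))` and `(1^l)`. -/
def columnPattern (a l : ℕ) : ℕ → ℕ → ℕ := fun i m => if i < l ∧ i < a + m then 1 else 0

theorem stripCount_columnPattern (a l n m : ℕ) (hn : n ≤ l) :
    stripCount (columnPattern a l) n m = if a + m < n then 1 else 0 := by
  have : ∀ i ∈ Finset.range n, columnPattern a l i (m + 1) - columnPattern a l i m =
      if i = a + m then 1 else 0 := by
    intro i hi
    have := Finset.mem_range.1 hi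
    simp only [columnPattern]
    split_ifs <;> omega
  rw [stripCount, Finset.sum_congr rfl this]
  simp

theorem stripCount_add {L L' : ℕ → ℕ → ℕ} (hL : ∀ i m, L i m ≤ L i (m + 1))
    (hL' : ∀ i m, L' i m ≤ L' i (m + 1)) (n m : ℕ) :
    stripCount (L + L') n m = stripCount L n m + stripCount L' n m := by
  rw [stripCount, stripCount, stripCount, ← Finset.sum_add_distrib]
  refine Finset.sum_congr rfl fun i _ => ?_
  have := hL i m
  have := hL' i m
  simp only [Pi.add_apply]
  omega

theorem columnPattern_mono (a l i m : ℕ) : columnPattern a l i m ≤ columnPattern a l i (m + 1) := by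
  simp only [columnPattern]
  split_ifs <;> omega

theorem columnPattern_col (a l i m : ℕ) :
    columnPattern a l (i + 1) (m + 1) ≤ columnPattern a l i m := by
  simp only [columnPattern]
  split_ifs <;> omega

namespace IsLRPattern

variable {l a b : ℕ} {lam mu ν : ℕ → ℕ} {L : ℕ → ℕ → ℕ}

theorem add_columnPattern (hL : IsLRPattern l lam mu ν L) (hab : a + b = l) :
    IsLRPattern l (fun i => lam i + if i < a then 1 else 0)
      (fun m => mu m + if m < b then 1 else 0) (fun i => ν i + if i < l then 1 else 0)
      (L + columnPattern a l) where
  zero i := by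
    simp only [Pi.add_apply, hL.zero, columnPattern]
    split_ifs <;> omega
  mono i m := add_le_add (hL.mono i m) (columnPattern_mono a l i m)
  le i m := by
    have := hL.le i m
    simp only [Pi.add_apply, columnPattern]
    split_ifs <;> omega
  eventually i := by
    obtain ⟨M, hM⟩ := hL.eventually i
    refine ⟨M + l, ?_⟩
    have := monotone_nat_of_le_succ (hL.mono i) (Nat.le_add_right M l)
    have := hL.le i (M + l)
    simp only [Pi.add_apply, columnPattern]
    split_ifs <;> omega
  col i m := add_le_add (hL.col i m) (columnPattern_col a l i m)
  content m := by
    rw [stripCount_add hL.mono (columnPattern_mono a l), hL.content,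
      stripCount_columnPattern _ _ _ _ le_rfl]
    congr 1
    split_ifs <;> omega
  ballot i m hi := by
    rw [stripCount_add hL.mono (columnPattern_mono a l),
      stripCount_add hL.mono (columnPattern_mono a l),
      stripCount_columnPattern _ _ _ _ hi, stripCount_columnPattern _ _ _ _ hi.le]
    have := hL.ballot i m hi
    split_ifs <;> omega

theorem stripCount_diagonal_antitone (hL : IsLRPattern l lam mu ν L) {p q : ℕ} (hpq : p ≤ q)
    (hq : a + q ≤ l) : stripCount L (a + q) q ≤ stripCount L (a + p) p := by
  induction q, hpq using Nat.le_induction with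
  | base => exact le_rfl
  | succ q _ ih => exact (hL.ballot (a + q) q (by omega)).trans (ih (by omega))

theorem stripCount_zero_add_le (hL : IsLRPattern l lam mu ν L) (n : ℕ) :
    stripCount L (n + 1) 0 + L n 0 ≤ ν 0 := by
  induction n with
  | zero =>
    have := hL.le 0 1
    have := hL.mono 0 0
    simp only [stripCount, zero_add, Finset.range_one, Finset.sum_singleton]
    simp only [zero_add] at this
    omega
  | succ n ih =>
    have := hL.col n 0
    have := hL.mono (n + 1) 0
    rw [stripCount_succ]
    simp only [zero_add] at *
    omega

/-- If `λ_a + μ_b > ν_1` with `a + b = l`, then row `a + p` contains an entry `p`, for all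
`p ≤ b` (in 1-indexed notation). -/
theorem lt_of_lt_add (hL : IsLRPattern l lam mu ν L) (hab : a + b = l)
    (hb : 0 < b → 0 < mu (b - 1))
    (h : 0 < a → 0 < b → ν 0 < lam (a - 1) + mu (b - 1)) {p : ℕ} (hp : p < b) :
    L (a + p) p < L (a + p) (p + 1) := by
  by_contra! hle
  have h1 : stripCount L (a + p + 1) p = stripCount L (a + p) p := by
    rw [stripCount_succ]
    omega
  have h2 := hL.stripCount_diagonal_antitone (a := a) (Nat.zero_le p) (by omega)
  have h3 := hL.stripCount_diagonal_antitone (a := a + 1) (p := p) (q := b - 1) (by omega)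
    (by omega)
  rw [show a + 1 + (b - 1) = l by omega, hL.content, show a + 1 + p = a + p + 1 by omega, h1] at h3
  rw [add_zero] at h2
  have h4 := hb (by omega)
  rcases a with _ | a
  · simp only [stripCount, Finset.range_zero, Finset.sum_empty] at h2 h3
    omega
  · have h5 := hL.stripCount_zero_add_le a
    have h6 := h (by omega) (by omega)
    rw [hL.zero] at h5
    simp only [Nat.add_sub_cancel] at h6
    omega

theorem columnPattern_le (hL : IsLRPattern l lam mu ν L) (hab : a + b = l)
    (ha : ∀ i, i < a → 0 < lam i)
    (hlt : ∀ p, p < b → L (a + p) p < L (a + p) (p + 1)) (i m : ℕ) :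
    columnPattern a l i m ≤ L i m := by
  rw [columnPattern]
  split_ifs with hi
  · by_cases hia : i < a
    · have h1 := ha i hia
      rw [← hL.zero] at h1
      have := monotone_nat_of_le_succ (hL.mono i) (Nat.zero_le m)
      omega
    · obtain ⟨p, rfl⟩ : ∃ p, i = a + p := ⟨i - a, by omega⟩
      have h1 := hlt p (by omega)
      have := monotone_nat_of_le_succ (hL.mono (a + p)) (show p + 1 ≤ m by omega)
      omega
  · exact Nat.zero_le _

theorem of_add_columnPattern (hab : a + b = l) (hν : ∀ i, l ≤ i → ν i = 0)
    (hlt : ∀ p, p < b →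
      (L + columnPattern a l) (a + p) p < (L + columnPattern a l) (a + p) (p + 1))
    (hL : IsLRPattern l (fun i => lam i + if i < a then 1 else 0)
      (fun m => mu m + if m < b then 1 else 0) (fun i => ν i + if i < l then 1 else 0)
      (L + columnPattern a l)) :
    IsLRPattern l lam mu ν L := by
  have hmono : ∀ i m, L i m ≤ L i (m + 1) := by
    intro i m
    have h1 := hL.mono i m
    simp only [Pi.add_apply, columnPattern] at h1
    by_cases him : i < l ∧ i = a + m
    · obtain ⟨him, rfl⟩ := him
      have h2 := hlt m (by omega)
      simp only [Pi.add_apply, columnPattern] at h2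
      split_ifs at h2 <;> omega
    · split_ifs at h1 <;> omega
  have hev : ∀ i, ∃ M, ∀ m, M ≤ m → L i m = ν i := by
    intro i
    obtain ⟨M, hM⟩ := hL.eventually i
    refine ⟨M + l, fun m hm => ?_⟩
    have h1 := monotone_nat_of_le_succ (hL.mono i) (show M ≤ m by omega)
    have h2 := hL.le i m
    simp only [Pi.add_apply, columnPattern] at hM h1 h2
    split_ifs at h1 h2 hM <;> omega
  have hle : ∀ i m, L i m ≤ ν i := by
    intro i m
    obtain ⟨M, hM⟩ := hev i
    have := monotone_nat_of_le_succ (hmono i) (Nat.le_add_left m M)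
    rwa [hM _ (Nat.le_add_right M m)] at this
  refine ⟨fun i => ?_, hmono, hle, fun i => ?_, fun i m => ?_, fun m => ?_, fun i m hi => ?_⟩
  · have h1 := hL.zero i
    simp only [Pi.add_apply, columnPattern] at h1
    split_ifs at h1 <;> omega
  · obtain ⟨M, hM⟩ := hev i
    exact ⟨M, hM M le_rfl⟩
  · have h1 := hL.col i m
    have h2 := hle (i + 1) (m + 1)
    have h3 := hν (i + 1)
    simp only [Pi.add_apply, columnPattern] at h1
    split_ifs at h1 <;> omega
  · have h1 := hL.content m
    rw [stripCount_add hmono (columnPattern_mono a l),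
      stripCount_columnPattern _ _ _ _ le_rfl] at h1
    split_ifs at h1 <;> omega
  · have h1 := hL.ballot i m hi
    rw [stripCount_add hmono (columnPattern_mono a l),
      stripCount_add hmono (columnPattern_mono a l),
      stripCount_columnPattern _ _ _ _ hi, stripCount_columnPattern _ _ _ _ hi.le] at h1
    split_ifs at h1 <;> omega

end IsLRPattern

theorem card_isLRPattern_add {l a b : ℕ} {lam mu ν : ℕ → ℕ} (hab : a + b = l)
    (hν : ∀ i, l ≤ i → ν i = 0)
    (h : 0 < a → 0 < b → ν 0 ≤ lam (a - 1) + mu (b - 1)) :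
    Nat.card {L // IsLRPattern l lam mu ν L} =
    Nat.card {L // IsLRPattern l (fun i => lam i + if i < a then 1 else 0)
      (fun m => mu m + if m < b then 1 else 0) (fun i => ν i + if i < l then 1 else 0) L} := by
  refine Nat.card_eq_of_bijective (fun L => ⟨L.1 + columnPattern a l, L.2.add_columnPattern hab⟩)
    ⟨fun L L' hLL => Subtype.ext (add_right_cancel (congrArg Subtype.val hLL)), ?_⟩
  rintro ⟨L, hL⟩
  have hlt : ∀ p, p < b → L (a + p) p < L (a + p) (p + 1) := by
    refine fun p => hL.lt_of_lt_add hab (fun hb => ?_) fun ha hb => ?_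
    · rw [if_pos (by omega)]
      omega
    · have := h ha hb
      rw [if_pos (by omega), if_pos (by omega), if_pos (by omega)]
      omega
  obtain ⟨L', rfl⟩ : ∃ L', L' + columnPattern a l = L := by
    refine ⟨fun i m => L i m - columnPattern a l i m, ?_⟩
    funext i m
    exact Nat.sub_add_cancel
      (hL.columnPattern_le hab (fun i hi => by rw [if_pos hi]; omega) hlt i m)
  exact ⟨⟨L', hL.of_add_columnPattern hab hν hlt⟩, rfl⟩

theorem antitone_add_ite {f : ℕ → ℕ} (hf : Antitone f) (n : ℕ) :
    Antitone fun i => f i + if i < n then 1 else 0 := by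
  intro i i' hi
  have := hf hi
  simp only
  split_ifs <;> omega

theorem lrCoeff_add_columns {l a b : ℕ} {lam mu ν : ℕ → ℕ} (hab : a + b = l)
    (hlam : Antitone lam) (hν' : Antitone ν) (hν : ∀ i, l ≤ i → ν i = 0) (hle : ∀ i, lam i ≤ ν i)
    (h : 0 < a → 0 < b → ν 0 ≤ lam (a - 1) + mu (b - 1)) :
    lrCoeff (fun i => lam i + if i < a then 1 else 0) (fun m => mu m + if m < b then 1 else 0)
      (fun i => ν i + if i < l then 1 else 0) = lrCoeff lam mu ν := by
  rw [lrCoeff_eq_card_pattern hlam hν' hν hle, card_isLRPattern_add hab hν h,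
    lrCoeff_eq_card_pattern (l := l) (antitone_add_ite hlam a) (antitone_add_ite hν' l)]
  · intro i hi
    simp only [hν i hi, if_neg hi.not_gt]
  · intro i
    have := hle i
    split_ifs <;> omega

theorem lrCoeff_max (lam mu ν : ℕ → ℕ) :
    lrCoeff lam mu (fun i => max (lam i) (ν i)) = lrCoeff lam mu ν := by
  have : InSkew (fun i => max (lam i) (ν i)) lam = InSkew ν lam := by
    funext c
    simp only [InSkew, eq_iff_iff]
    omega
  simp only [lrCoeff, IsLRFilling, this]

theorem InRect.antitone {f : ℕ → ℕ} {l k : ℕ} (h : InRect f l k) : Antitone f :=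
  fun i i' hi => h.1.1 i i' hi

theorem InRect.of_antitone {f : ℕ → ℕ} {l k : ℕ} (hf : Antitone f) (h0 : f 0 ≤ k)
    (hl : ∀ i, l ≤ i → f i = 0) : InRect f l k :=
  ⟨⟨fun _ _ hi => hf hi, l, hl⟩, h0, hl⟩

theorem InRect.max {f g : ℕ → ℕ} {l k : ℕ} (hf : InRect f l k) (hg : InRect g l k) :
    InRect (fun i => max (f i) (g i)) l k := by
  refine .of_antitone (fun i i' hi => max_le_max (hf.antitone hi) (hg.antitone hi))
    (max_le hf.2.1 hg.2.1) fun i hi => ?_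
  simp only [hf.2.2 i hi, hg.2.2 i hi, max_self]

theorem exists_le_iff_lt_of_antitone {f : ℕ → ℕ} {l : ℕ} (hf : Antitone f)
    (hl : ∀ i, l ≤ i → f i = 0) (j : ℕ) : ∃ a ≤ l, ∀ i, j < f i ↔ i < a := by
  classical
  have hex : ∃ a, f a ≤ j := ⟨l, by rw [hl l le_rfl]; exact Nat.zero_le j⟩
  refine ⟨Nat.find hex, Nat.find_min' _ (by rw [hl l le_rfl]; exact Nat.zero_le j), fun i => ?_⟩
  rw [Nat.lt_find_iff]
  constructor
  · intro h i' hi'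
    have := hf hi'
    omega
  · exact fun h => not_le.1 (h i le_rfl)

theorem delCol_antitone {f : ℕ → ℕ} (hf : Antitone f) (j : ℕ) : Antitone (delCol f j) := by
  intro i i' hi
  have := hf hi
  simp only [delCol]
  split_ifs <;> omega

/-- The rows meeting a full column split into the first `a`, which meet it in `λ`, and the
last `b`, which meet it in `rotate(μ)`. -/
theorem FullCol.exists_split {lam mu : ℕ → ℕ} {l k j : ℕ} (hfull : FullCol lam mu l k j)
    (hlam : InRect lam l k) (hmu : InRect mu l k) (hdisj : DisjointPlace lam mu l k)
    (hj : j < k) :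
    ∃ a b, a + b = l ∧ (∀ i, j < lam i ↔ i < a) ∧ ∀ i, k - j ≤ mu i ↔ i < b := by
  obtain ⟨a, hal, ha⟩ := exists_le_iff_lt_of_antitone hlam.antitone hlam.2.2 j
  refine ⟨a, l - a, by omega, ha, fun i => ?_⟩
  by_cases hi : i < l
  · have h1 := hfull (l - 1 - i) (by omega)
    have h2 := hdisj (l - 1 - i, j) (by simp only; omega) hj
    have h3 := ha (l - 1 - i)
    simp only [InLam, InRot, show l - 1 - (l - 1 - i) = i by omega] at h1 h2
    omega
  · rw [hmu.2.2 i (by omega)]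
    omega

/-- If `λ ∪ rotate(μ)` contains a full column of `l × k` and `λ̃, μ̃ ⊆ l × (k-1)` are
obtained by deleting it, then `c^ν_{λ,μ}` has a coefficient `≥ 2` for some
`ν ⊆ l × k` iff `c^{ν̃}_{λ̃,μ̃}` has a coefficient `≥ 2` for some `ν̃ ⊆ l × (k-1)`. -/
theorem stmt4 (lam mu : ℕ → ℕ) (l k j : ℕ)
    (hlam : InRect lam l k) (hmu : InRect mu l k)
    (hdisj : DisjointPlace lam mu l k)
    (hj : j < k) (hfull : FullCol lam mu l k j) :
    (∃ ν : ℕ → ℕ, InRect ν l k ∧ 2 ≤ lrCoeff lam mu ν) ↔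
    (∃ ν : ℕ → ℕ, InRect ν l (k - 1) ∧
      2 ≤ lrCoeff (delCol lam j) (delColMu k mu j) ν) := by
  obtain ⟨a, b, hab, ha, hb⟩ := hfull.exists_split hlam hmu hdisj hj
  have hlam_eq : lam = fun i => delCol lam j i + if i < a then 1 else 0 := by
    funext i
    have := ha i
    simp only [delCol]
    split_ifs <;> omega
  have hmu_eq : mu = fun i => delColMu k mu j i + if i < b then 1 else 0 := by
    funext i
    have := hb i
    simp only [delColMu]
    split_ifs <;> omega
  have hanti := delCol_antitone hlam.antitone j
  have hbound : 0 < a → 0 < b →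
      k - 1 ≤ delCol lam j (a - 1) + delColMu k mu j (b - 1) := by
    intro ha0 hb0
    have h1 := (ha (a - 1)).2 (by omega)
    have h2 := (hb (b - 1)).2 (by omega)
    rw [delCol, delColMu, if_pos h1, if_pos h2]
    omega
  have key : ∀ ν, InRect ν l (k - 1) → (∀ i, delCol lam j i ≤ ν i) →
      lrCoeff lam mu (fun i => ν i + if i < l then 1 else 0) =
        lrCoeff (delCol lam j) (delColMu k mu j) ν := by
    intro ν hν hle
    have := lrCoeff_add_columns hab hanti hν.antitone hν.2.2 hle
      fun ha0 hb0 => hν.2.1.trans (hbound ha0 hb0)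
    rwa [← hlam_eq, ← hmu_eq] at this
  constructor
  · rintro ⟨ν₀, hν₀, h2⟩
    rw [← lrCoeff_max] at h2
    have hν := hlam.max hν₀
    obtain ⟨ν, hνeq⟩ : ∃ ν, ν = fun i => max (lam i) (ν₀ i) := ⟨_, rfl⟩
    have hle : ∀ i, lam i ≤ ν i := fun i => by rw [hνeq]; exact le_max_left _ _
    rw [← hνeq] at h2 hν
    have hpat := h2
    rw [lrCoeff_eq_card_pattern hlam.antitone hν.antitone hν.2.2 hle] at hpat
    obtain ⟨L, hL⟩ := (Nat.card_pos_iff.1 (two_pos.trans_le hpat)).1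
    have hlt : ∀ i, a ≤ i → i < l → lam i < ν i := by
      intro i hai hil
      obtain ⟨p, rfl⟩ : ∃ p, i = a + p := ⟨i - a, by omega⟩
      have h1 := hL.lt_of_lt_add hab (fun hb0 => ?_) (fun ha0 hb0 => ?_) (show p < b by omega)
      · have h3 := monotone_nat_of_le_succ (hL.mono (a + p)) (Nat.zero_le p)
        have h4 := hL.le (a + p) (p + 1)
        rw [hL.zero] at h3
        omega
      · have := (hb (b - 1)).2 (by omega)
        omega
      · have h3 := (ha (a - 1)).2 (by omega)
        have h4 := (hb (b - 1)).2 (by omega)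
        have := hν.2.1
        omega
    have hpos : ∀ i, i < l → 0 < ν i := by
      intro i hi
      rcases lt_or_ge i a with hia | hia
      · have := (ha i).2 hia
        have := hle i
        omega
      · have := hlt i hia hi
        omega
    have hν' : InRect (fun i => ν i - 1) l (k - 1) := by
      refine .of_antitone (fun i i' hi => Nat.sub_le_sub_right (hν.antitone hi) 1)
        (Nat.sub_le_sub_right hν.2.1 1) fun i hi => ?_
      simp only [hν.2.2 i hi, Nat.zero_sub]
    refine ⟨_, hν', ?_⟩
    rw [← key _ hν' fun i => ?_]
    · convert h2 using 2
      funext i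
      rcases lt_or_ge i l with hi | hi
      · have := hpos i hi
        rw [if_pos hi]
        omega
      · rw [if_neg hi.not_gt, hν.2.2 i hi]
    · have h1 := hle i
      have h3 := ha i
      have h4 := hlt i
      have h5 := hlam.2.2 i
      simp only [delCol]
      split_ifs <;> omega
  · rintro ⟨ν₀, hν₀, h2⟩
    rw [← lrCoeff_max] at h2
    have hdel : InRect (delCol lam j) l (k - 1) := by
      refine .of_antitone hanti ?_ fun i hi => ?_
      · have := hlam.2.1
        rw [delCol]
        split_ifs <;> omega
      · rw [delCol, hlam.2.2 i hi]
        split_ifs <;> rfl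
    have hν := hdel.max hν₀
    rw [← key _ hν fun i => le_max_left _ _] at h2
    refine ⟨_, .of_antitone (antitone_add_ite hν.antitone l) ?_ fun i hi => ?_, h2⟩
    · have := hν.2.1
      simp only at this
      split_ifs <;> omega
    · have := hν.2.2 i hi
      simp only at this
      simp only [this, if_neg hi.not_gt]
end

section
/- Let λ ⊆ ℓ×k have at least three distinct part sizes and let μ = (g^h) be a rectangle with 2 ≤ g ≤ k−2 and h = 2. If (λ, μ, ℓ×k) is a basic Richardson quadruple, then there exists a partition ν ⊆ ℓ×k with c^ν_{λ,μ} ≥ 2. -/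
/-- The filling of the shape obtained from `lam` by adding, in row `i`, `a i` ones
followed by `b i` twos. -/
def onesTwosFilling (lam a b : ℕ → ℕ) (c : ℕ × ℕ) : ℕ :=
  if c.2 < lam c.1 then 0 else
    if c.2 < lam c.1 + a c.1 then 1 else
      if c.2 < lam c.1 + a c.1 + b c.1 then 2 else 0

theorem finite_and_ncard_rowwise_Ico (p q : ℕ → ℕ) (n : ℕ) :
    {c : ℕ × ℕ | c.1 < n ∧ p c.1 ≤ c.2 ∧ c.2 < p c.1 + q c.1}.Finite ∧
    {c : ℕ × ℕ | c.1 < n ∧ p c.1 ≤ c.2 ∧ c.2 < p c.1 + q c.1}.ncard =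
      ∑ i ∈ Finset.range n, q i := by
  classical
  have h : {c : ℕ × ℕ | c.1 < n ∧ p c.1 ≤ c.2 ∧ c.2 < p c.1 + q c.1} =
      ↑(((Finset.range n).sigma fun i => Finset.Ico (p i) (p i + q i)).map
        (Equiv.sigmaEquivProd ℕ ℕ).toEmbedding) := by
    ext ⟨i, j⟩
    simp [Equiv.sigmaEquivProd, Sigma.exists]
  rw [h]
  refine ⟨Finset.finite_toSet _, ?_⟩
  rw [Set.ncard_coe_finset, Finset.card_map, Finset.card_sigma]
  simp

theorem isLRFilling_onesTwosFilling (lam a b : ℕ → ℕ) (g l : ℕ)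
    (h_ones : ∀ i, lam (i + 1) + a (i + 1) ≤ lam i)
    (h_twos : ∀ i, lam (i + 1) + a (i + 1) + b (i + 1) ≤ lam i + a i)
    (h_ballot : ∀ n, ∑ i ∈ Finset.range (n + 1), b i ≤ ∑ i ∈ Finset.range n, a i)
    (ha : ∀ i, l ≤ i → a i = 0) (hb : ∀ i, l ≤ i → b i = 0)
    (hsa : ∑ i ∈ Finset.range l, a i = g) (hsb : ∑ i ∈ Finset.range l, b i = g) :
    IsLRFilling lam (rectP g 2) (fun i => lam i + a i + b i) (onesTwosFilling lam a b) := by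
  have eq_one : ∀ c, onesTwosFilling lam a b c = 1 ↔
      lam c.1 ≤ c.2 ∧ c.2 < lam c.1 + a c.1 := by
    intro c; grind [onesTwosFilling]
  have eq_two : ∀ c, onesTwosFilling lam a b c = 2 ↔
      lam c.1 + a c.1 ≤ c.2 ∧ c.2 < lam c.1 + a c.1 + b c.1 := by
    intro c; grind [onesTwosFilling]
  have le_two : ∀ c, onesTwosFilling lam a b c ≤ 2 := by
    intro c; unfold onesTwosFilling; split_ifs <;> omega
  have set_ones : {c | InSkew (fun i => lam i + a i + b i) lam c ∧
      onesTwosFilling lam a b c = 0 + 1} =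
      {c : ℕ × ℕ | c.1 < l ∧ lam c.1 ≤ c.2 ∧ c.2 < lam c.1 + a c.1} := by
    ext c
    have := ha c.1
    simp only [Set.mem_ofPred_eq, InSkew, zero_add, eq_one]
    omega
  have set_twos : {c | InSkew (fun i => lam i + a i + b i) lam c ∧
      onesTwosFilling lam a b c = 1 + 1} =
      {c : ℕ × ℕ | c.1 < l ∧ lam c.1 + a c.1 ≤ c.2 ∧ c.2 < lam c.1 + a c.1 + b c.1} := by
    ext c
    have := hb c.1
    simp only [Set.mem_ofPred_eq, InSkew, Nat.reduceAdd, eq_two]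
    omega
  have set_ones_fin := finite_and_ncard_rowwise_Ico lam a l
  have set_twos_fin := finite_and_ncard_rowwise_Ico (fun i => lam i + a i) b l
  refine ⟨?_, ?_, ?_, ?_, ?_, ?_⟩
  · intro c hc
    simp only [InSkew] at hc
    unfold onesTwosFilling
    split_ifs <;> omega
  · intro c hc
    simp only [InSkew] at hc
    unfold onesTwosFilling
    split_ifs <;> omega
  · intro i j j' hc hc' hj
    simp only [InSkew] at hc hc'
    unfold onesTwosFilling
    dsimp only
    split_ifs <;> omega
  · intro i j hc hc'
    simp only [InSkew] at hc hc'
    have := h_ones i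
    have := h_twos i
    unfold onesTwosFilling
    dsimp only
    split_ifs <;> omega
  · intro m
    match m with
    | 0 => rw [set_ones, set_ones_fin.2]; exact ⟨set_ones_fin.1, by simpa [rectP] using hsa⟩
    | 1 => rw [set_twos, set_twos_fin.2]; exact ⟨set_twos_fin.1, by simpa [rectP] using hsb⟩
    | m + 2 =>
      have h : {c | InSkew (fun i => lam i + a i + b i) lam c ∧
          onesTwosFilling lam a b c = m + 2 + 1} = ∅ := by
        ext c
        have := le_two c
        simp only [Set.mem_ofPred_eq, Set.mem_empty_iff_false, iff_false]
        omega
      rw [h]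
      simp [rectP]
  · intro c hc m hm
    obtain rfl | hm := hm.eq_or_lt
    · have twos := finite_and_ncard_rowwise_Ico (fun i => lam i + a i) b (c.1 + 1)
      have ones := finite_and_ncard_rowwise_Ico lam a c.1
      refine (Set.ncard_le_ncard ?_ twos.1).trans
        ((twos.2.trans_le (h_ballot c.1)).trans (ones.2.symm.trans_le (Set.ncard_le_ncard ?_ ?_)))
      · rintro d ⟨_, hd, hd'⟩
        replace hd' := (eq_two d).1 hd'
        refine ⟨?_, hd'⟩
        rcases hd with (hd | hd) | rfl <;> omega
      · rintro d ⟨hd, hd'⟩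
        refine ⟨?_, Or.inl (Or.inl hd), (eq_one d).2 hd'⟩
        simp only [InSkew]
        omega
      · rw [← set_ones] at set_ones_fin
        exact set_ones_fin.1.subset fun d hd => ⟨hd.1, hd.2.2⟩
    · have h : {c' | InSkew (fun i => lam i + a i + b i) lam c' ∧
          (ReadBefore c' c ∨ c' = c) ∧ onesTwosFilling lam a b c' = m + 1} = ∅ := by
        ext d
        have := le_two d
        simp only [Set.mem_ofPred_eq, Set.mem_empty_iff_false, iff_false]
        omega
      rw [h]
      simp

theorem finite_lrFilling_rectP_two (lam ν : ℕ → ℕ) (g l k : ℕ) (hν : InRect ν l k) :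
    Finite {T : ℕ × ℕ → ℕ // IsLRFilling lam (rectP g 2) ν T} := by
  have bound : ∀ T : {T : ℕ × ℕ → ℕ // IsLRFilling lam (rectP g 2) ν T}, ∀ c, T.1 c < 3 := by
    rintro ⟨T, h0, -, -, -, hcount, -⟩ c
    by_contra! hc
    have hs : InSkew ν lam c := by
      by_contra h
      have := h0 c h
      simp only at hc
      omega
    obtain ⟨hfin, hcard⟩ := hcount (T c - 1)
    have hzero : rectP g 2 (T c - 1) = 0 := by
      simp only at hc
      simp only [rectP]
      split_ifs <;> omega
    rw [hzero, Set.ncard_eq_zero hfin] at hcard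
    have : c ∈ {d | InSkew ν lam d ∧ T d = T c - 1 + 1} := ⟨hs, by simp only at hc; omega⟩
    simp [hcard] at this
  refine Finite.of_injective
    (β := Fin l × Fin k → Fin 3) (fun T c => ⟨T.1 (c.1, c.2), bound T _⟩) ?_
  intro T T' h
  ext ⟨i, j⟩
  by_cases hc : i < l ∧ j < k
  · simpa using congrFun h (⟨i, hc.1⟩, ⟨j, hc.2⟩)
  · have hs : ¬ InSkew ν lam (i, j) := by
      rintro ⟨-, h2⟩
      have h0 := hν.1.1 0 i (Nat.zero_le i)
      have h1 := hν.2.1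
      have h3 := hν.2.2 i
      simp only at h2
      omega
    rw [T.2.1 _ hs, T'.2.1 _ hs]

theorem exists_le_sum_range_eq (M : ℕ → ℕ) (n s : ℕ) (hs : s ≤ ∑ i ∈ Finset.range n, M i) :
    ∃ A : ℕ → ℕ, (∀ i, A i ≤ M i) ∧ (∀ i, n ≤ i → A i = 0) ∧
      ∑ i ∈ Finset.range n, A i = s := by
  induction n generalizing s with
  | zero => exact ⟨0, by simp, by simp, by simp at hs ⊢; omega⟩
  | succ n ih =>
    rw [Finset.sum_range_succ] at hs
    obtain ⟨A, hA, hA0, hsum⟩ := ih (s - M n) (by omega)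
    refine ⟨Function.update A n (min s (M n)), ?_, ?_, ?_⟩
    · intro i
      by_cases h : i = n
      · subst h; simp
      · simpa [h] using hA i
    · intro i hi
      rw [Function.update_of_ne (by omega)]
      exact hA0 i (by omega)
    · rw [Finset.sum_range_succ, Function.update_self, Finset.sum_congr rfl (g := A), hsum]
      · omega
      · intro i hi
        rw [Function.update_of_ne]
        have := Finset.mem_range.1 hi
        omega

theorem exists_three_descents (lam : ℕ → ℕ) (hlam : IsPartition lam)
    (hsize : 3 ≤ numPartSizes lam) :
    ∃ r₁ r₂ r₃, r₁ < r₂ ∧ r₂ < r₃ ∧ lam (r₁ + 1) < lam r₁ ∧ lam (r₂ + 1) < lam r₂ ∧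
      lam (r₃ + 1) = 0 ∧ 0 < lam r₃ := by
  obtain ⟨hanti, N, hN⟩ := hlam
  have key : ∀ v w, ∃ i, lam i ≠ 0 ∧ lam i ≠ v ∧ lam i ≠ w := by
    intro v w
    by_contra! h
    have hsub : {n | n ≠ 0 ∧ ∃ i, lam i = n} ⊆ {v, w} := by
      rintro n ⟨hn, i, rfl⟩
      by_cases hv : lam i = v
      · exact Or.inl hv
      · exact Or.inr (h i hn hv)
    have h1 := Set.ncard_le_ncard hsub (by simp)
    have h2 := Set.ncard_insert_le v {w}
    rw [Set.ncard_singleton] at h2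
    unfold numPartSizes at hsize
    omega
  have h0 : 0 < lam 0 := by
    obtain ⟨i, hi, -⟩ := key 0 0
    have := hanti 0 i (Nat.zero_le i)
    omega
  have next : ∀ v, 0 < v → v ≤ lam 0 → ∃ r, lam (r + 1) < v ∧ v ≤ lam r := by
    intro v hv hv0
    have hne : ∃ i, lam (i + 1) < v := ⟨N, by rw [hN _ (by omega)]; exact hv⟩
    classical
    refine ⟨Nat.find hne, Nat.find_spec hne, ?_⟩
    rcases h : Nat.find hne with _ | i
    · exact hv0
    · exact not_lt.1 (Nat.find_min hne (by omega))
  obtain ⟨r₁, h₁, h₁'⟩ := next (lam 0) h0 le_rfl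
  have anti : ∀ i j, lam j < lam i → i < j := by
    intro i j h
    by_contra! hij
    have := hanti j i hij
    omega
  have between : ∀ i r, lam i < lam r → lam i ≤ lam (r + 1) := fun i r h =>
    hanti _ _ (anti _ _ h)
  obtain ⟨i, hi, hi0, hi1⟩ := key (lam 0) (lam (r₁ + 1))
  have top : ∀ i, lam i ≤ lam 0 := fun i => hanti 0 i (Nat.zero_le i)
  have hr₁ : lam r₁ = lam 0 := le_antisymm (top _) h₁'
  have hb₁ := between i r₁ (by have := top i; omega)
  obtain ⟨r₂, h₂, h₂'⟩ := next (lam (r₁ + 1)) (by omega) h₁.le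
  have hi2 : lam i ≤ lam (r₂ + 1) := between i r₂ (by omega)
  obtain ⟨r₃, h₃, h₃'⟩ := next 1 one_pos h0
  have : r₁ + 1 < r₂ + 1 := anti _ _ h₂
  have : r₂ + 1 < r₃ + 1 := anti _ _ (by omega)
  exact ⟨r₁, r₂, r₃, by omega, by omega, by omega, by omega, by omega, by omega⟩

theorem two_le_lrCoeff_of_onesTwos (lam a b a' b' : ℕ → ℕ) (g l k r : ℕ)
    (hν : InRect (fun i => lam i + a i + b i) l k)
    (hT : IsLRFilling lam (rectP g 2) (fun i => lam i + a i + b i) (onesTwosFilling lam a b))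
    (hT' : IsLRFilling lam (rectP g 2) (fun i => lam i + a' i + b' i)
      (onesTwosFilling lam a' b'))
    (hab : ∀ i, a i + b i = a' i + b' i) (hr : a' r < a r) :
    2 ≤ lrCoeff lam (rectP g 2) (fun i => lam i + a i + b i) := by
  have hshape : (fun i => lam i + a' i + b' i) = fun i => lam i + a i + b i := by
    funext i
    have := hab i
    omega
  rw [hshape] at hT'
  have := finite_lrFilling_rectP_two lam _ g l k hν
  have : Nontrivial {T : ℕ × ℕ → ℕ //
      IsLRFilling lam (rectP g 2) (fun i => lam i + a i + b i) T} := by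
    refine ⟨⟨_, hT⟩, ⟨_, hT'⟩, fun h => ?_⟩
    have h' := congrFun (Subtype.ext_iff.1 h) (r, lam r + a' r)
    have := hab r
    simp only [onesTwosFilling] at h'
    split_ifs at h' <;> omega
  exact Finite.one_lt_card

theorem sum_range_indicator_eq (n r : ℕ) :
    ∑ i ∈ Finset.range n, (if i = r then 1 else 0) = if r < n then 1 else 0 := by
  simp [Finset.sum_ite_eq']

/-- If `λ ⊆ l × k` has at least three distinct part sizes, `μ = (g^2)` with
`2 ≤ g ≤ k - 2`, and `(λ, μ, l × k)` is a basic Richardson quadruple, then some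
LR coefficient is at least 2. -/
theorem stmt9 (lam : ℕ → ℕ) (g l k : ℕ)
    (hsize : 3 ≤ numPartSizes lam) (hg : 2 ≤ g) (hg' : g ≤ k - 2)
    (hbasic : BasicRQ lam (rectP g 2) l k) :
    ∃ ν : ℕ → ℕ, InRect ν l k ∧ 2 ≤ lrCoeff lam (rectP g 2) ν := by
  obtain ⟨⟨hpart, hlam0, hlaml⟩, -, -, hcol, hrow⟩ := hbasic
  obtain ⟨r₁, r₂, r₃, h12, h23, hd₁, hd₂, hz, hd₃⟩ := exists_three_descents lam hpart hsize
  have hanti := hpart.1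
  obtain ⟨n, hr₃n, rfl⟩ : ∃ n, r₃ ≤ n ∧ l = n + 2 := by
    have h := hcol 0 (by omega)
    simp only [FullCol, InLam, InRot, not_forall, not_or] at h
    obtain ⟨i, hi, hi0, -⟩ := h
    have : r₃ < i := by
      by_contra! hle
      have := hanti i r₃ hle
      omega
    exact ⟨l - 2, by omega, by omega⟩
  have hlamn : lam n < k - g := by
    have h := hrow n (by omega)
    simp only [FullRow, InLam, InRot, not_forall, not_or] at h
    obtain ⟨j, hj, h1, h2⟩ := h
    simp only [rectP, show n + 2 - 1 - n < 2 by omega, if_true] at h2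
    omega
  have hlam0' : lam 0 < k := by
    have h := hrow 0 (by omega)
    simp only [FullRow, InLam, not_forall, not_or] at h
    obtain ⟨j, hj, h1, -⟩ := h
    omega
  obtain ⟨N, hN0, hNs⟩ : ∃ N : ℕ → ℕ, N 0 = k - lam 0 ∧ ∀ i, N (i + 1) = lam i - lam (i + 1) :=
    ⟨fun i => Nat.casesOn i (k - lam 0) fun i => lam i - lam (i + 1), rfl, fun _ => rfl⟩
  have hNsum : ∀ m, ∑ i ∈ Finset.range (m + 1), N i = k - lam m := by
    intro m
    induction m with
    | zero => simp [hN0]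
    | succ m ih =>
      rw [Finset.sum_range_succ, ih]
      have := hanti m (m + 1) (by omega)
      have := hanti 0 m (by omega)
      simp only [hNs]
      omega
  set δ : ℕ → ℕ → ℕ := fun r i => if i = r then 1 else 0 with hδ
  have hδ_le : ∀ i, δ 0 i + δ (r₁ + 1) i + δ (r₂ + 1) i + δ (r₃ + 1) i ≤ N i := by
    rintro (_ | i)
    · simp [hδ, hN0]; omega
    · simp only [hδ, hNs, Nat.add_right_cancel_iff]
      rw [if_neg (Nat.succ_ne_zero i)]
      grind
  have hδsum : ∀ r m, ∑ i ∈ Finset.range m, δ r i = if r < m then 1 else 0 :=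
    fun r m => sum_range_indicator_eq m r
  obtain ⟨A, hAM, hA0, hAsum⟩ := exists_le_sum_range_eq
    (fun i => N i - (δ 0 i + δ (r₁ + 1) i + δ (r₂ + 1) i + δ (r₃ + 1) i)) (n + 1) (g - 2) (by
      have h1 : ∑ i ∈ Finset.range (n + 1), N i = _ :=
        Finset.sum_congr rfl fun i _ => (Nat.sub_add_cancel (hδ_le i)).symm
      simp only [Finset.sum_add_distrib, hδsum, hNsum] at h1
      by_cases hlast : r₃ = n
      · subst hlast
        split_ifs at h1 <;> omega
      · have := hanti (r₃ + 1) n (by omega)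
        split_ifs at h1 <;> omega)
  have hA : ∀ i, A i + (δ 0 i + δ (r₁ + 1) i + δ (r₂ + 1) i + δ (r₃ + 1) i) ≤ N i := by
    intro i
    have := hAM i
    have := hδ_le i
    omega
  obtain ⟨B, hB0, hBs⟩ : ∃ B : ℕ → ℕ, B 0 = 0 ∧ ∀ i, B (i + 1) = A i :=
    ⟨fun i => Nat.casesOn i 0 A, rfl, fun _ => rfl⟩
  have hBsum : ∀ m, ∑ i ∈ Finset.range (m + 1), B i = ∑ i ∈ Finset.range m, A i := by
    intro m
    rw [Finset.sum_range_succ']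
    simp [hB0, hBs]
  have hδlate : ∀ r i, r < i → δ r i = 0 := fun r i h => by simp [hδ]; omega
  have filling : ∀ s t, (s = r₁ + 1 ∧ t = r₂ + 1 ∨ s = r₂ + 1 ∧ t = r₁ + 1) →
      IsLRFilling lam (rectP g 2)
        (fun i => lam i + (A i + δ 0 i + δ s i) + (B i + δ t i + δ (r₃ + 1) i))
        (onesTwosFilling lam (fun i => A i + δ 0 i + δ s i)
          fun i => B i + δ t i + δ (r₃ + 1) i) := by
    intro s t hst
    have hδst : ∀ i, δ (r₁ + 1) i + δ (r₂ + 1) i = δ s i + δ t i := by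
      intro i
      rcases hst with ⟨rfl, rfl⟩ | ⟨rfl, rfl⟩ <;> omega
    refine isLRFilling_onesTwosFilling lam _ _ g (n + 2) ?_ ?_ ?_ ?_ ?_ ?_ ?_
    · intro i
      have := hA (i + 1)
      have := hδst (i + 1)
      have := hanti i (i + 1) (by omega)
      simp only [hN0, hNs] at *
      omega
    · intro i
      have := hA (i + 1)
      have := hδst (i + 1)
      have := hanti i (i + 1) (by omega)
      simp only [hN0, hNs, hB0, hBs] at *
      omega
    · intro m
      simp only [Finset.sum_add_distrib, hδsum, hBsum]
      split_ifs <;> omega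
    · intro i hi
      simp only [hA0 i (by omega), hδlate 0 i (by omega), hδlate s i (by omega)]
    · intro i hi
      obtain ⟨i, rfl⟩ : ∃ j, i = j + 1 := ⟨i - 1, by omega⟩
      simp only [hBs, hA0 i (by omega), hδlate t (i + 1) (by omega),
        hδlate (r₃ + 1) (i + 1) (by omega)]
    · simp only [Finset.sum_add_distrib, hδsum]
      rw [Finset.sum_range_succ, hAsum, hA0 (n + 1) le_rfl]
      split_ifs <;> omega
    · simp only [Finset.sum_add_distrib, hδsum]
      rw [hBsum, hAsum]
      split_ifs <;> omega
  have hν : InRect (fun i => lam i + (A i + δ 0 i + δ (r₁ + 1) i) +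
      (B i + δ (r₂ + 1) i + δ (r₃ + 1) i)) (n + 2) k := by
    have hzero : ∀ i, n + 2 ≤ i → lam i + (A i + δ 0 i + δ (r₁ + 1) i) +
        (B i + δ (r₂ + 1) i + δ (r₃ + 1) i) = 0 := by
      intro i hi
      obtain ⟨i, rfl⟩ : ∃ j, i = j + 1 := ⟨i - 1, by omega⟩
      simp only [hBs, hlaml (i + 1) hi, hA0 i (by omega), hA0 (i + 1) (by omega),
        hδlate 0 (i + 1) (by omega), hδlate (r₁ + 1) (i + 1) (by omega),
        hδlate (r₂ + 1) (i + 1) (by omega), hδlate (r₃ + 1) (i + 1) (by omega)]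
    refine ⟨⟨?_, n + 2, hzero⟩, ?_, hzero⟩
    · intro i j hij
      refine antitone_nat_of_succ_le (f := fun i => lam i + (A i + δ 0 i + δ (r₁ + 1) i) +
        (B i + δ (r₂ + 1) i + δ (r₃ + 1) i)) (fun i => ?_) hij
      have := hA (i + 1)
      have := hanti i (i + 1) (by omega)
      simp only [hN0, hNs, hB0, hBs] at *
      omega
    · have := hA 0
      simp only [hN0, hNs, hB0, hBs] at *
      omega
  refine ⟨_, hν, two_le_lrCoeff_of_onesTwos lam _ _ _ _ g (n + 2) k (r₁ + 1) hν
    (filling _ _ (Or.inl ⟨rfl, rfl⟩)) (filling _ _ (Or.inr ⟨rfl, rfl⟩)) (fun i => ?_) ?_⟩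
  · omega
  · simp [hδ]
    omega
end
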